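/- Let (τ,u) be a C¹ solution of the system whose Riemann invariants w = u + φ, z = u − φ are twice continuously differentiable, and set c_w := (γ+1)/(2(γ−1)) K_c φ^{2/(γ−1)}. Then at every point, (c^{1/2} w_x)′ = −(α c^{1/2}/(2(1+t)^λ))(z + w)_x − c^{1/2} c_w (w_x)² and (c^{1/2} z_x)‵ = −(α c^{1/2}/(2(1+t)^λ))(z + w)_x − c^{1/2} c_w (z_x)². -/

import Mathlib

open Real Set MeasureTheory

/-- Partial derivative in the space variable `x`. -/
noncomputable def pdx (f : ℝ → ℝ → ℝ) (x t : ℝ) : ℝ := deriv (fun y => f y t) x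

/-- Partial derivative in the time variable `t`. -/
noncomputable def pdt (f : ℝ → ℝ → ℝ) (x t : ℝ) : ℝ := deriv (fun s => f x s) t

/-- `(τ, u)` is a `C¹` solution of the compressible Euler equations with
time-dependent damping `τ_t - u_x = 0`, `u_t + p_x = -(α/(1+t)^λ) u`,
`p = K τ^{-γ}`, on `ℝ × [0,∞)`. -/
def IsSol (K γ α lam : ℝ) (τ u : ℝ → ℝ → ℝ) : Prop :=
  ContDiff ℝ 1 (fun p : ℝ × ℝ => τ p.1 p.2) ∧
  ContDiff ℝ 1 (fun p : ℝ × ℝ => u p.1 p.2) ∧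
  (∀ x t, 0 ≤ t → 0 < τ x t) ∧
  (∀ x t, 0 ≤ t → pdt τ x t = pdx u x t) ∧
  (∀ x t, 0 ≤ t →
    pdt u x t + pdx (fun y s => K * τ y s ^ (-γ)) x t = -(α / (1 + t) ^ lam) * u x t)

/-- `φ = (2√(Kγ)/(γ-1)) τ^{-(γ-1)/2}`. -/
noncomputable def Phi (K γ : ℝ) (τ : ℝ → ℝ → ℝ) (x t : ℝ) : ℝ :=
  (2 * Real.sqrt (K * γ) / (γ - 1)) * τ x t ^ (-(γ - 1) / 2)

/-- `K_τ = (2√(Kγ)/(γ-1))^{2/(γ-1)}`. -/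
noncomputable def Ktau (K γ : ℝ) : ℝ := (2 * Real.sqrt (K * γ) / (γ - 1)) ^ (2 / (γ - 1))

/-- `K_c = √(Kγ) K_τ^{-(γ+1)/2}`. -/
noncomputable def Kc (K γ : ℝ) : ℝ := Real.sqrt (K * γ) * Ktau K γ ^ (-(γ + 1) / 2)

/-- Blow-up of `‖(τ_x, u_x)‖_{L^∞}` in finite time. -/
def BlowsUp (τ u : ℝ → ℝ → ℝ) : Prop :=
  ∃ T > (0 : ℝ),
    ¬ BddAbove {r : ℝ | ∃ x t, 0 ≤ t ∧ t ≤ T ∧ r = |pdx τ x t| + |pdx u x t|}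

theorem hasDerivAt_pdx {f : ℝ → ℝ → ℝ} {x t : ℝ}
    (hf : DifferentiableAt ℝ (fun p : ℝ × ℝ => f p.1 p.2) (x, t)) :
    HasDerivAt (fun y => f y t) (pdx f x t) x := by
  have h : DifferentiableAt ℝ (fun y : ℝ => f y t) x :=
    DifferentiableAt.comp x (f := fun y : ℝ => (y, t)) hf (by fun_prop)
  exact h.hasDerivAt

theorem hasDerivAt_pdt {f : ℝ → ℝ → ℝ} {x t : ℝ}
    (hf : DifferentiableAt ℝ (fun p : ℝ × ℝ => f p.1 p.2) (x, t)) :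
    HasDerivAt (fun s => f x s) (pdt f x t) t := by
  have h : DifferentiableAt ℝ (fun s : ℝ => f x s) t :=
    DifferentiableAt.comp t (f := fun s : ℝ => (x, s)) hf (by fun_prop)
  exact h.hasDerivAt

theorem pdx_eq_fderiv {f : ℝ → ℝ → ℝ} {x t : ℝ}
    (hf : DifferentiableAt ℝ (fun p : ℝ × ℝ => f p.1 p.2) (x, t)) :
    pdx f x t = fderiv ℝ (fun p : ℝ × ℝ => f p.1 p.2) (x, t) (1, 0) := by
  have h1 : HasDerivAt (fun y : ℝ => (y, t)) (1, 0) x :=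
    (hasDerivAt_id x).prodMk (hasDerivAt_const x t)
  exact (hf.hasFDerivAt.comp_hasDerivAt x h1).deriv

theorem pdt_eq_fderiv {f : ℝ → ℝ → ℝ} {x t : ℝ}
    (hf : DifferentiableAt ℝ (fun p : ℝ × ℝ => f p.1 p.2) (x, t)) :
    pdt f x t = fderiv ℝ (fun p : ℝ × ℝ => f p.1 p.2) (x, t) (0, 1) := by
  have h1 : HasDerivAt (fun s : ℝ => (x, s)) (0, 1) t :=
    (hasDerivAt_const t x).prodMk (hasDerivAt_id t)
  exact (hf.hasFDerivAt.comp_hasDerivAt t h1).deriv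

/-- The mixed second partial derivatives of a `C²` function agree. -/
theorem exists_hasDerivAt_pdx_pdt {f : ℝ → ℝ → ℝ}
    (hf : ContDiff ℝ 2 (fun p : ℝ × ℝ => f p.1 p.2)) (x t : ℝ) :
    ∃ fxx fxt, HasDerivAt (fun y => pdx f y t) fxx x ∧
      HasDerivAt (fun s => pdx f x s) fxt t ∧ HasDerivAt (fun y => pdt f y t) fxt x := by
  have hd : Differentiable ℝ (fun p : ℝ × ℝ => f p.1 p.2) := hf.differentiable (by norm_num)
  have hd2 : Differentiable ℝ (fderiv ℝ (fun p : ℝ × ℝ => f p.1 p.2)) :=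
    (hf.fderiv_right (m := 1) (by norm_num)).differentiable (by norm_num)
  have hsymm : IsSymmSndFDerivAt ℝ (fun p : ℝ × ℝ => f p.1 p.2) (x, t) :=
    hf.contDiffAt.isSymmSndFDerivAt (by simp)
  have hx : HasDerivAt (fun y : ℝ => (y, t)) (1, 0) x :=
    (hasDerivAt_id x).prodMk (hasDerivAt_const x t)
  have ht : HasDerivAt (fun s : ℝ => (x, s)) (0, 1) t :=
    (hasDerivAt_const t x).prodMk (hasDerivAt_id t)
  have hDx := (hd2 (x, t)).hasFDerivAt.comp_hasDerivAt x hx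
  have hDt := (hd2 (x, t)).hasFDerivAt.comp_hasDerivAt t ht
  have epdx : ∀ a b, pdx f a b = _ := fun a b => pdx_eq_fderiv (hd (a, b))
  have epdt : ∀ a b, pdt f a b = _ := fun a b => pdt_eq_fderiv (hd (a, b))
  refine ⟨fderiv ℝ (fderiv ℝ (fun p : ℝ × ℝ => f p.1 p.2)) (x, t) (1, 0) (1, 0),
    fderiv ℝ (fderiv ℝ (fun p : ℝ × ℝ => f p.1 p.2)) (x, t) (0, 1) (1, 0), ?_, ?_, ?_⟩
  · simp only [epdx]
    simpa using hDx.clm_apply (hasDerivAt_const x ((1, 0) : ℝ × ℝ))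
  · simp only [epdx]
    simpa using hDt.clm_apply (hasDerivAt_const t ((1, 0) : ℝ × ℝ))
  · simp only [epdt]
    rw [hsymm.eq]
    simpa using hDx.clm_apply (hasDerivAt_const x ((0, 1) : ℝ × ℝ))

/-- Differentiating the transport equation `f_t + σ c f_x = -a u` in space gives the evolution of
`√c f_x` along the characteristics of speed `σ c`. -/
theorem transport_sqrt_mul_pdx {f c u : ℝ → ℝ → ℝ} {x t σ a cx ct ux : ℝ}
    (hf : ContDiff ℝ 2 (fun p : ℝ × ℝ => f p.1 p.2))
    (hcx : HasDerivAt (fun y => c y t) cx x) (hct : HasDerivAt (fun s => c x s) ct t)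
    (hux : HasDerivAt (fun y => u y t) ux x) (hc : 0 < c x t)
    (heq : ∀ y, pdt f y t + σ * c y t * pdx f y t = -a * u y t) :
    pdt (fun y s => √(c y s) * pdx f y s) x t
        + σ * c x t * pdx (fun y s => √(c y s) * pdx f y s) x t =
      (ct + σ * c x t * cx) / (2 * √(c x t)) * pdx f x t
        - √(c x t) * (σ * cx * pdx f x t + a * ux) := by
  obtain ⟨fxx, fxt, hxx, hxt, htx⟩ := exists_hasDerivAt_pdx_pdt hf x t
  have e1 : fxt + (σ * cx * pdx f x t + σ * c x t * fxx) = -a * ux :=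
    (htx.add ((hcx.const_mul σ).mul hxx)).unique
      ((hux.const_mul (-a)).congr_of_eventuallyEq (.of_forall heq))
  have eT : pdt (fun y s => √(c y s) * pdx f y s) x t = _ :=
    ((hct.sqrt hc.ne').mul hxt).deriv
  have eX : pdx (fun y s => √(c y s) * pdx f y s) x t = _ :=
    ((hcx.sqrt hc.ne').mul hxx).deriv
  rw [eT, eX]
  linear_combination √(c x t) * e1

theorem Kc_mul_Phi_rpow {K γ : ℝ} (hK : 0 < K) (hγ : 1 < γ) {τ : ℝ → ℝ → ℝ} {x t : ℝ}
    (hτ : 0 < τ x t) :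
    Kc K γ * Phi K γ τ x t ^ (2 / (γ - 1)) = (γ - 1) / (2 * τ x t) := by
  have hs : 0 < √(K * γ) := Real.sqrt_pos.2 (by positivity)
  have hg : 0 < γ - 1 := by linarith
  have hB : 0 < 2 * √(K * γ) / (γ - 1) := by positivity
  have h1 : (τ x t ^ (-(γ - 1) / 2)) ^ (2 / (γ - 1)) = (τ x t)⁻¹ := by
    rw [← Real.rpow_mul hτ.le, ← Real.rpow_neg_one]
    congr 1
    field_simp
  have h2 : ((2 * √(K * γ) / (γ - 1)) ^ (2 / (γ - 1))) ^ (-(γ + 1) / 2)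
      * (2 * √(K * γ) / (γ - 1)) ^ (2 / (γ - 1)) = (2 * √(K * γ) / (γ - 1))⁻¹ := by
    rw [← Real.rpow_mul hB.le, ← Real.rpow_add hB, ← Real.rpow_neg_one]
    congr 1
    field_simp
    ring
  unfold Kc Ktau Phi
  rw [Real.mul_rpow hB.le (by positivity), h1]
  calc _ = √(K * γ) * (((2 * √(K * γ) / (γ - 1)) ^ (2 / (γ - 1))) ^ (-(γ + 1) / 2)
      * (2 * √(K * γ) / (γ - 1)) ^ (2 / (γ - 1))) * (τ x t)⁻¹ := by ring
    _ = _ := by rw [h2]; field_simp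

/-- Derivative of the Riemann function `φ` along a curve: `dφ = -c dτ`. -/
theorem hasDerivAt_riemann {K γ : ℝ} (hγ : 1 < γ) {g : ℝ → ℝ} {g' s : ℝ}
    (hg : HasDerivAt g g' s) (hpos : 0 < g s) :
    HasDerivAt (fun r => (2 * √(K * γ) / (γ - 1)) * g r ^ (-(γ - 1) / 2))
      (-(√(K * γ) * g s ^ (-(γ + 1) / 2)) * g') s := by
  have hg1 : γ - 1 ≠ 0 := by linarith
  refine ((hg.rpow_const (p := -(γ - 1) / 2) (.inl hpos.ne')).const_mul
    (2 * √(K * γ) / (γ - 1))).congr_deriv ?_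
  rw [show -(γ - 1) / 2 - 1 = -(γ + 1) / 2 by ring]
  field_simp

/-- Derivative of the wave speed `c` along a curve: `dc = -(γ+1)/(2τ) c dτ`. -/
theorem hasDerivAt_speed {K γ : ℝ} {g : ℝ → ℝ} {g' s : ℝ}
    (hg : HasDerivAt g g' s) (hpos : 0 < g s) :
    HasDerivAt (fun r => √(K * γ) * g r ^ (-(γ + 1) / 2))
      (-(γ + 1) / (2 * g s) * (√(K * γ) * g s ^ (-(γ + 1) / 2)) * g') s := by
  refine ((hg.rpow_const (p := -(γ + 1) / 2) (.inl hpos.ne')).const_mul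
    (√(K * γ))).congr_deriv ?_
  rw [Real.rpow_sub_one hpos.ne']
  field_simp

/-- Derivative of the pressure along a curve: `dp = -c² dτ`. -/
theorem hasDerivAt_pressure {K γ : ℝ} (hK : 0 < K) (hγ : 1 < γ) {g : ℝ → ℝ} {g' s : ℝ}
    (hg : HasDerivAt g g' s) (hpos : 0 < g s) :
    HasDerivAt (fun r => K * g r ^ (-γ))
      (-(√(K * γ) * g s ^ (-(γ + 1) / 2)) ^ 2 * g') s := by
  refine ((hg.rpow_const (p := -γ) (.inl hpos.ne')).const_mul K).congr_deriv ?_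
  rw [mul_pow, Real.sq_sqrt (by positivity), ← Real.rpow_mul_natCast hpos.le,
    show -(γ + 1) / 2 * ((2 : ℕ) : ℝ) = -γ - 1 by push_cast; ring]
  ring

theorem stmt15 (K γ α lam : ℝ) (hK : 0 < K) (hγ : 1 < γ)
    (τ u : ℝ → ℝ → ℝ) (hsol : IsSol K γ α lam τ u)
    (w z c cw : ℝ → ℝ → ℝ)
    (hw : w = fun x t => u x t + Phi K γ τ x t)
    (hz : z = fun x t => u x t - Phi K γ τ x t)
    (hw2 : ContDiff ℝ 2 (fun p : ℝ × ℝ => w p.1 p.2))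
    (hz2 : ContDiff ℝ 2 (fun p : ℝ × ℝ => z p.1 p.2))
    (hc : c = fun x t => Real.sqrt (K * γ) * τ x t ^ (-(γ + 1) / 2))
    (hcw : cw = fun x t => (γ + 1) / (2 * (γ - 1)) * Kc K γ * Phi K γ τ x t ^ (2 / (γ - 1)))
    (F G : ℝ → ℝ → ℝ)
    (hF : F = fun x t => Real.sqrt (c x t) * pdx w x t)
    (hG : G = fun x t => Real.sqrt (c x t) * pdx z x t)
    (x t : ℝ) (ht : 0 ≤ t) :
    pdt F x t + c x t * pdx F x t =
        -(α * Real.sqrt (c x t) / (2 * (1 + t) ^ lam)) * (pdx z x t + pdx w x t) -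
          Real.sqrt (c x t) * cw x t * pdx w x t ^ 2 ∧
    pdt G x t - c x t * pdx G x t =
        -(α * Real.sqrt (c x t) / (2 * (1 + t) ^ lam)) * (pdx z x t + pdx w x t) -
          Real.sqrt (c x t) * cw x t * pdx z x t ^ 2 := by
  obtain ⟨hτ1, hu1, hpos, hmass, hmom⟩ := hsol
  have hτd : ∀ y s, DifferentiableAt ℝ (fun p : ℝ × ℝ => τ p.1 p.2) (y, s) :=
    fun y s => hτ1.differentiable (by norm_num) _
  have hud : ∀ y s, DifferentiableAt ℝ (fun p : ℝ × ℝ => u p.1 p.2) (y, s) :=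
    fun y s => hu1.differentiable (by norm_num) _
  have ec : ∀ y s, √(K * γ) * τ y s ^ (-(γ + 1) / 2) = c y s := fun y s => by rw [hc]
  have hφx : ∀ y, HasDerivAt (fun r => Phi K γ τ r t) (-c y t * pdx τ y t) y := fun y => by
    rw [← ec]; exact hasDerivAt_riemann hγ (hasDerivAt_pdx (hτd y t)) (hpos y t ht)
  have hφt : ∀ y, HasDerivAt (fun r => Phi K γ τ y r) (-c y t * pdt τ y t) t := fun y => by
    rw [← ec]; exact hasDerivAt_riemann hγ (hasDerivAt_pdt (hτd y t)) (hpos y t ht)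
  have ep : ∀ y, pdx (fun y s => K * τ y s ^ (-γ)) y t = -c y t ^ 2 * pdx τ y t := fun y => by
    rw [← ec]
    exact (hasDerivAt_pressure hK hγ (hasDerivAt_pdx (hτd y t)) (hpos y t ht)).deriv
  have ewx : ∀ y, pdx w y t = pdx u y t + -c y t * pdx τ y t := fun y => by
    rw [hw]; exact ((hasDerivAt_pdx (hud y t)).add (hφx y)).deriv
  have ezx : ∀ y, pdx z y t = pdx u y t - -c y t * pdx τ y t := fun y => by
    rw [hz]; exact ((hasDerivAt_pdx (hud y t)).sub (hφx y)).deriv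
  have ewt : ∀ y, pdt w y t = pdt u y t + -c y t * pdt τ y t := fun y => by
    rw [hw]; exact ((hasDerivAt_pdt (hud y t)).add (hφt y)).deriv
  have ezt : ∀ y, pdt z y t = pdt u y t - -c y t * pdt τ y t := fun y => by
    rw [hz]; exact ((hasDerivAt_pdt (hud y t)).sub (hφt y)).deriv
  have hcx : HasDerivAt (fun y => c y t) (-(γ + 1) / (2 * τ x t) * c x t * pdx τ x t) x := by
    rw [hc]; exact hasDerivAt_speed (hasDerivAt_pdx (hτd x t)) (hpos x t ht)
  have hct : HasDerivAt (fun s => c x s) (-(γ + 1) / (2 * τ x t) * c x t * pdx u x t) t := by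
    rw [hc, ← hmass x t ht]; exact hasDerivAt_speed (hasDerivAt_pdt (hτd x t)) (hpos x t ht)
  have hτ0 := hpos x t ht
  have hc0 : 0 < c x t := by
    have : 0 < √(K * γ) := Real.sqrt_pos.2 (by positivity)
    rw [← ec]; positivity
  have ecw : cw x t = (γ + 1) / (4 * τ x t) := by
    have hg : γ - 1 ≠ 0 := by linarith
    rw [hcw]
    simp only [mul_assoc, Kc_mul_Phi_rpow hK hγ hτ0]
    field_simp
    norm_num
  have heqw : ∀ y, pdt w y t + 1 * c y t * pdx w y t = -(α / (1 + t) ^ lam) * u y t := fun y => by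
    rw [ewt, ewx, ← hmom y t ht, ep, hmass y t ht]; ring
  have heqz : ∀ y, pdt z y t + -1 * c y t * pdx z y t = -(α / (1 + t) ^ lam) * u y t := fun y => by
    rw [ezt, ezx, ← hmom y t ht, ep, hmass y t ht]; ring
  have hW := transport_sqrt_mul_pdx hw2 hcx hct (hasDerivAt_pdx (hud x t)) hc0 heqw
  have hZ := transport_sqrt_mul_pdx hz2 hcx hct (hasDerivAt_pdx (hud x t)) hc0 heqz
  rw [← hF] at hW
  rw [← hG] at hZ
  have hq : 0 < √(c x t) := Real.sqrt_pos.2 hc0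
  have hA : 0 < (1 + t) ^ lam := by positivity
  have hqq : c x t = √(c x t) ^ 2 := (Real.sq_sqrt hc0.le).symm
  rw [ewx] at hW ⊢
  rw [ezx] at hZ ⊢
  rw [ecw]
  generalize √(c x t) = q at *
  constructor
  · rw [one_mul] at hW
    rw [hW, hqq]
    field_simp
    ring
  · rw [show pdt G x t - c x t * pdx G x t = pdt G x t + -1 * c x t * pdx G x t by ring, hZ, hqq]
    field_simp
    ring
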